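/- arXiv:2207.03438 — 4 statements merged into one kernel-verified Lean document; each statement's English description precedes it below -/
import Mathlib

section
/- In the simple-interest model: for any x > 0 and α ∈ 𝒜 with θ(α) < T, there exists a unique t_0 ∈ [0, θ(α)] satisfying ∫_0^{θ(α)} α(s) ds = ∫_0^{t_0} m(s) ds + ∫_{t_0}^{θ(α)} M(s) ds; moreover, the strategy ᾱ defined by ᾱ(t) := m(t)·1_{[0,t_0]}(t) + M(t)·1_{(t_0,θ(α)]}(t) + α(t)·1_{(θ(α),T]}(t) belongs to 𝒜 and satisfies θ(ᾱ) = θ(α) and J(x, ᾱ) ≤ J(x, α). -/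
open MeasureTheory Set

noncomputable section

/-- Admissible repayment strategies: measurable, with `m t ≤ α t ≤ M t` on `[0,T]`. -/
def Adm (T : ℝ) (m M : ℝ → ℝ) : Set (ℝ → ℝ) :=
  {α | Measurable α ∧ ∀ t ∈ Icc (0:ℝ) T, m t ≤ α t ∧ α t ≤ M t}

/-- Compound-interest balance. -/
def balC (r β x : ℝ) (α : ℝ → ℝ) (t : ℝ) : ℝ :=
  Real.exp ((r + β) * t) * (x - ∫ s in (0:ℝ)..t, Real.exp (-(r + β) * s) * α s)

/-- Terminal time: first zero of the balance in `[0,T]`, capped at `T`. -/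
def tauC (r β T x : ℝ) (α : ℝ → ℝ) : ℝ :=
  sInf (insert T {t | t ∈ Icc (0:ℝ) T ∧ balC r β x α t = 0})

/-- Repayment cost. -/
def costC (r β T ω x : ℝ) (α : ℝ → ℝ) : ℝ :=
  (∫ t in (0:ℝ)..(tauC r β T x α), Real.exp (-r * t) * α t)
    + ω * Real.exp (-r * tauC r β T x α) * balC r β x α (tauC r β T x α)

/-- Value function. -/
def valC (r β T ω : ℝ) (m M : ℝ → ℝ) (x : ℝ) : ℝ :=
  sInf (costC r β T ω x '' Adm T m M)

/-- Critical horizon `t_c = max(T + log ω / β, 0)`. -/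
def tCrit (β T ω : ℝ) : ℝ := max (T + Real.log ω / β) 0

/-- The cost `v₁` of the max-min strategy. -/
def vOne (r β T ω : ℝ) (m M : ℝ → ℝ) (x : ℝ) : ℝ :=
  (∫ s in (0:ℝ)..(tCrit β T ω), Real.exp (-r * s) * M s)
  + (∫ s in (tCrit β T ω)..T, Real.exp (-r * s) * m s)
  + ω * Real.exp (β * T) *
    (x - (∫ s in (0:ℝ)..(tCrit β T ω), Real.exp (-(r + β) * s) * M s)
       - ∫ s in (tCrit β T ω)..T, Real.exp (-(r + β) * s) * m s)

/-- `x̂ = ∫_0^{t_c} e^{-(r+β)s} M(s) ds`. -/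
def xHat (r β T ω : ℝ) (M : ℝ → ℝ) : ℝ :=
  ∫ s in (0:ℝ)..(tCrit β T ω), Real.exp (-(r + β) * s) * M s

/-- `x̄ = ∫_0^T e^{-(r+β)s} M(s) ds`. -/
def xBar (r β T : ℝ) (M : ℝ → ℝ) : ℝ :=
  ∫ s in (0:ℝ)..T, Real.exp (-(r + β) * s) * M s

/-- `x̲ = ∫_0^T e^{-(r+β)s} m(s) ds`. -/
def xLow (r β T : ℝ) (m : ℝ → ℝ) : ℝ :=
  ∫ s in (0:ℝ)..T, Real.exp (-(r + β) * s) * m s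

/-- `x_c = ∫_0^{t_c} e^{-(r+β)s} M(s) ds + ∫_{t_c}^T e^{-(r+β)s} m(s) ds`. -/
def xCrit (r β T ω : ℝ) (m M : ℝ → ℝ) : ℝ :=
  xHat r β T ω M + ∫ s in (tCrit β T ω)..T, Real.exp (-(r + β) * s) * m s
/-- Running infimum of the balance: the principal. -/
def runInf (b : ℝ → ℝ) (t : ℝ) : ℝ := sInf (b '' Icc (0:ℝ) t)

/-- The simple-interest balance equation: `b` is continuous on `[0,T]`,
`b_t = x + ∫_0^t ((r+β) p_s − α_s) ds`, with `p` the running infimum of `b`. -/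
def SimpleBal (r β T x : ℝ) (α b : ℝ → ℝ) : Prop :=
  ContinuousOn b (Icc (0:ℝ) T) ∧
  ∀ t ∈ Icc (0:ℝ) T, b t = x + ∫ s in (0:ℝ)..t, ((r + β) * runInf b s - α s)

/-- First time of principal repayment, with `inf ∅ = T`. -/
def thetaS (T x : ℝ) (b : ℝ → ℝ) : ℝ :=
  sInf (insert T {t | t ∈ Icc (0:ℝ) T ∧ runInf b t < x})

/-- Terminal time in the simple-interest model. -/
def tauS (T : ℝ) (b : ℝ → ℝ) : ℝ :=
  sInf (insert T {t | t ∈ Icc (0:ℝ) T ∧ b t = 0})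

/-- Repayment cost in the simple-interest model. -/
def costS (r T ω : ℝ) (α b : ℝ → ℝ) : ℝ :=
  (∫ t in (0:ℝ)..(tauS T b), Real.exp (-r * t) * α t)
    + ω * Real.exp (-r * tauS T b) * b (tauS T b)

theorem MeasureTheory.IntegrableOn.intervalIntegrable_of_mem_Icc {f : ℝ → ℝ} {c d u v : ℝ}
    (hf : IntegrableOn f (Icc c d)) (hu : u ∈ Icc c d) (hv : v ∈ Icc c d) :
    IntervalIntegrable f volume u v :=
  (hf.mono_set (ordConnected_Icc.uIcc_subset hu hv)).intervalIntegrable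

theorem runInf_le {b : ℝ → ℝ} {T s t : ℝ} (hb : ContinuousOn b (Icc (0:ℝ) T)) (ht : t ≤ T)
    (hs : s ∈ Icc (0:ℝ) t) : runInf b t ≤ b s :=
  csInf_le ((isCompact_Icc.image_of_continuousOn
    (hb.mono (Icc_subset_Icc_right ht))).bddBelow) (mem_image_of_mem b hs)

theorem le_runInf {b : ℝ → ℝ} {c t : ℝ} (ht : 0 ≤ t) (h : ∀ s ∈ Icc (0:ℝ) t, c ≤ b s) :
    c ≤ runInf b t := by
  refine le_csInf ((nonempty_Icc.2 ht).image b) ?_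
  rintro _ ⟨s, hs, rfl⟩
  exact h s hs

theorem antitoneOn_runInf {b : ℝ → ℝ} {T : ℝ} (hb : ContinuousOn b (Icc (0:ℝ) T)) :
    AntitoneOn (runInf b) (Icc (0:ℝ) T) := fun _ hs _ ht hst =>
  le_runInf hs.1 fun _ hu => runInf_le hb ht.2 ⟨hu.1, hu.2.trans hst⟩

theorem intervalIntegrable_runInf {b : ℝ → ℝ} {T t : ℝ} (hb : ContinuousOn b (Icc (0:ℝ) T))
    (ht : t ∈ Icc (0:ℝ) T) : IntervalIntegrable (runInf b) volume 0 t := by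
  refine AntitoneOn.intervalIntegrable ((antitoneOn_runInf hb).mono ?_)
  rw [uIcc_of_le ht.1]
  exact Icc_subset_Icc_right ht.2

theorem abs_runInf_sub_le {b₁ b₂ : ℝ → ℝ} {T t B : ℝ} (h₁ : ContinuousOn b₁ (Icc (0:ℝ) T))
    (h₂ : ContinuousOn b₂ (Icc (0:ℝ) T)) (ht : t ∈ Icc (0:ℝ) T)
    (h : ∀ s ∈ Icc (0:ℝ) t, |b₁ s - b₂ s| ≤ B) : |runInf b₁ t - runInf b₂ t| ≤ B := by
  have h12 : runInf b₂ t - B ≤ runInf b₁ t := le_runInf ht.1 fun s hs => by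
    linarith [runInf_le h₂ ht.2 hs, abs_le.1 (h s hs)]
  have h21 : runInf b₁ t - B ≤ runInf b₂ t := le_runInf ht.1 fun s hs => by
    linarith [runInf_le h₁ ht.2 hs, abs_le.1 (h s hs)]
  exact abs_le.2 ⟨by linarith, by linarith⟩

/-- The simple-interest balance equation has at most one solution on `[0,T]`. -/
theorem SimpleBal.eqOn {r β T x : ℝ} {α b₁ b₂ : ℝ → ℝ} (hK : 0 ≤ r + β)
    (hα : ∀ t ∈ Icc (0:ℝ) T, IntervalIntegrable α volume 0 t)
    (h₁ : SimpleBal r β T x α b₁) (h₂ : SimpleBal r β T x α b₂) :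
    EqOn b₁ b₂ (Icc (0:ℝ) T) := by
  obtain ⟨C, hC⟩ := isCompact_Icc.exists_bound_of_continuousOn (h₁.1.sub h₂.1)
  have key : ∀ n : ℕ, ∀ t ∈ Icc (0:ℝ) T,
      |b₁ t - b₂ t| ≤ C * (((r + β) * t) ^ n / n.factorial) := by
    intro n
    induction n with
    | zero => intro t ht; simpa using hC t ht
    | succ n ih =>
      intro t ht
      have hC0 : 0 ≤ C := (norm_nonneg _).trans (hC t ht)
      have hi₁ := (intervalIntegrable_runInf h₁.1 ht).const_mul (r + β)
      have hi₂ := (intervalIntegrable_runInf h₂.1 ht).const_mul (r + β)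
      have hdiff : b₁ t - b₂ t
          = ∫ s in (0:ℝ)..t, (r + β) * (runInf b₁ s - runInf b₂ s) := by
        rw [h₁.2 t ht, h₂.2 t ht, intervalIntegral.integral_sub hi₁ (hα t ht),
          intervalIntegral.integral_sub hi₂ (hα t ht)]
        simp only [mul_sub]
        rw [intervalIntegral.integral_sub hi₁ hi₂]
        ring
      have hle : ‖∫ s in (0:ℝ)..t, (r + β) * (runInf b₁ s - runInf b₂ s)‖
          ≤ ∫ s in (0:ℝ)..t, (r + β) * (C * (((r + β) * s) ^ n / n.factorial)) := by
        refine intervalIntegral.norm_integral_le_of_norm_le ht.1 ?_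
          (Continuous.intervalIntegrable (by fun_prop) _ _)
        refine Filter.Eventually.of_forall fun s hs => ?_
        rw [norm_mul, Real.norm_of_nonneg hK]
        refine mul_le_mul_of_nonneg_left ?_ hK
        refine abs_runInf_sub_le h₁.1 h₂.1 ⟨hs.1.le, hs.2.trans ht.2⟩ fun u hu => ?_
        refine (ih u ⟨hu.1, hu.2.trans (hs.2.trans ht.2)⟩).trans ?_
        have := mul_nonneg hK hu.1
        have := hu.2
        gcongr
      rw [hdiff]
      refine hle.trans (le_of_eq ?_)
      have hf : ∀ s : ℝ, (r + β) * (C * (((r + β) * s) ^ n / n.factorial))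
          = ((r + β) ^ (n + 1) * C / n.factorial) * s ^ n := fun s => by
        rw [mul_pow]; ring
      simp only [hf]
      rw [intervalIntegral.integral_const_mul, integral_pow, Nat.factorial_succ, mul_pow]
      push_cast
      field_simp
      simp
  intro t ht
  have hlim := (FloorSemiring.tendsto_pow_div_factorial_atTop ((r + β) * t)).const_mul C
  rw [mul_zero] at hlim
  have := ge_of_tendsto' hlim fun n => key n t ht
  exact sub_eq_zero.1 (abs_nonpos_iff.1 this)

theorem thetaS_mem {T x : ℝ} {b : ℝ → ℝ} (hT : 0 ≤ T) : thetaS T x b ∈ Icc (0:ℝ) T := by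
  have hlb : (0:ℝ) ∈ lowerBounds (insert T {t | t ∈ Icc (0:ℝ) T ∧ runInf b t < x}) := by
    rintro t (rfl | ht)
    exacts [hT, ht.1.1]
  exact ⟨le_csInf (insert_nonempty _ _) hlb, csInf_le ⟨0, hlb⟩ (mem_insert _ _)⟩

/-- Up to the first time of principal repayment the balance stays above its initial value. -/
theorem le_of_le_thetaS {T x t : ℝ} {b : ℝ → ℝ} (hT : 0 ≤ T)
    (hb : ContinuousOn b (Icc (0:ℝ) T)) (h0 : x ≤ b 0) (ht : t ∈ Icc (0:ℝ) (thetaS T x b)) :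
    x ≤ b t := by
  have hθ := thetaS_mem (x := x) (b := b) hT
  have hlt : ∀ s ∈ Ico (0:ℝ) (thetaS T x b), x ≤ b s := fun s hs => by
    have hsT : s ∈ Icc (0:ℝ) T := ⟨hs.1, hs.2.le.trans hθ.2⟩
    by_contra! hlt
    refine hs.2.not_ge (csInf_le ⟨0, ?_⟩ (mem_insert_of_mem _ ⟨hsT, ?_⟩))
    · rintro u (rfl | hu)
      exacts [hT, hu.1.1]
    · exact (runInf_le hb hsT.2 ⟨hs.1, le_rfl⟩).trans_lt hlt
  rcases ht.1.eq_or_lt with rfl | hpos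
  · exact h0
  have hcl : t ∈ closure (Ico (0:ℝ) (thetaS T x b)) := by
    rw [closure_Ico (hpos.trans_le ht.2).ne]
    exact ht
  have hcont : ContinuousWithinAt b (Ico (0:ℝ) (thetaS T x b)) t :=
    (hb t ⟨ht.1, ht.2.trans hθ.2⟩).mono fun s hs => ⟨hs.1, hs.2.le.trans hθ.2⟩
  have := mem_closure_iff_nhdsWithin_neBot.1 hcl
  exact ge_of_tendsto hcont (Filter.eventually_of_mem self_mem_nhdsWithin hlt)

/-- Raising a solution before the first time of principal repayment by the payments postponed
leaves the principal unchanged, so it solves the equation for the new strategy. -/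
theorem SimpleBal.postpone {r β T x : ℝ} {α α' b : ℝ → ℝ} (hT : 0 ≤ T)
    (hα : IntegrableOn α (Icc (0:ℝ) T)) (hα' : IntegrableOn α' (Icc (0:ℝ) T))
    (hb : SimpleBal r β T x α b)
    (hle : ∀ t ∈ Icc (0:ℝ) (thetaS T x b), ∫ s in (0:ℝ)..t, α' s ≤ ∫ s in (0:ℝ)..t, α s)
    (heq : ∀ t ∈ Icc (thetaS T x b) T, ∫ s in (0:ℝ)..t, α' s = ∫ s in (0:ℝ)..t, α s) :
    (∀ t ∈ Icc (0:ℝ) T, runInf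
        (fun t => b t + ((∫ s in (0:ℝ)..t, α s) - ∫ s in (0:ℝ)..t, α' s)) t = runInf b t) ∧
      SimpleBal r β T x α'
        (fun t => b t + ((∫ s in (0:ℝ)..t, α s) - ∫ s in (0:ℝ)..t, α' s)) := by
  have hθ := thetaS_mem (x := x) (b := b) hT
  have hii : ∀ {f : ℝ → ℝ}, IntegrableOn f (Icc (0:ℝ) T) → ∀ t ∈ Icc (0:ℝ) T,
      IntervalIntegrable f volume 0 t := fun hf t ht =>
    hf.intervalIntegrable_of_mem_Icc ⟨le_rfl, hT⟩ ht
  have hcont : ∀ {f : ℝ → ℝ}, IntegrableOn f (Icc (0:ℝ) T) →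
      ContinuousOn (fun t => ∫ s in (0:ℝ)..t, f s) (Icc (0:ℝ) T) := fun hf => by
    rw [← uIcc_of_le hT] at hf ⊢
    exact intervalIntegral.continuousOn_primitive_interval hf
  set b' : ℝ → ℝ := fun t => b t + ((∫ s in (0:ℝ)..t, α s) - ∫ s in (0:ℝ)..t, α' s) with hb'
  have hcb' : ContinuousOn b' (Icc (0:ℝ) T) := hb.1.add ((hcont hα).sub (hcont hα'))
  have h0 : b 0 = x := by simpa using hb.2 0 ⟨le_rfl, hT⟩
  have hrun : ∀ t ∈ Icc (0:ℝ) T, runInf b' t = runInf b t := by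
    intro t ht
    refine le_antisymm (le_runInf ht.1 fun s hs => ?_) (le_runInf ht.1 fun s hs => ?_)
    · rcases le_total s (thetaS T x b) with hsθ | hsθ
      · calc runInf b' t ≤ b' 0 := runInf_le hcb' ht.2 ⟨le_rfl, ht.1⟩
          _ = x := by simp [hb', h0]
          _ ≤ b s := le_of_le_thetaS hT hb.1 h0.ge ⟨hs.1, hsθ⟩
      · refine (runInf_le hcb' ht.2 hs).trans_eq ?_
        simp [hb', heq s ⟨hsθ, hs.2.trans ht.2⟩]
    · refine (runInf_le hb.1 ht.2 hs).trans ?_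
      have : ∫ s in (0:ℝ)..s, α' s ≤ ∫ s in (0:ℝ)..s, α s := by
        rcases le_total s (thetaS T x b) with hsθ | hsθ
        exacts [hle s ⟨hs.1, hsθ⟩, (heq s ⟨hsθ, hs.2.trans ht.2⟩).le]
      simp only [hb']
      linarith
  refine ⟨hrun, hcb', fun t ht => ?_⟩
  have hp := (intervalIntegrable_runInf hb.1 ht).const_mul (r + β)
  have hcongr : ∫ s in (0:ℝ)..t, ((r + β) * runInf b' s - α' s)
      = ∫ s in (0:ℝ)..t, ((r + β) * runInf b s - α' s) := by
    refine intervalIntegral.integral_congr fun s hs => ?_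
    rw [uIcc_of_le ht.1] at hs
    simp only [hrun s ⟨hs.1, hs.2.trans ht.2⟩]
  rw [hcongr, intervalIntegral.integral_sub hp (hii hα' t ht)]
  simp only [hb']
  rw [hb.2 t ht, intervalIntegral.integral_sub hp (hii hα t ht)]
  ring

theorem integrableOn_of_mem_Adm {T : ℝ} {m M α : ℝ → ℝ}
    (hm : IntegrableOn m (Icc (0:ℝ) T)) (hM : IntegrableOn M (Icc (0:ℝ) T))
    (hα : α ∈ Adm T m M) : IntegrableOn α (Icc (0:ℝ) T) :=
  integrable_of_le_of_le hα.1.aestronglyMeasurable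
    (ae_restrict_of_forall_mem measurableSet_Icc fun t ht => (hα.2 t ht).1)
    (ae_restrict_of_forall_mem measurableSet_Icc fun t ht => (hα.2 t ht).2) hm hM

/-- The switching time from `m` to `M` that reproduces the total of `α` over `[0,a]`. -/
theorem existsUnique_switch {a : ℝ} {m M α : ℝ → ℝ} (ha : 0 ≤ a)
    (hm : IntegrableOn m (Icc (0:ℝ) a)) (hM : IntegrableOn M (Icc (0:ℝ) a))
    (hαi : IntegrableOn α (Icc (0:ℝ) a)) (hmM : ∀ t ∈ Icc (0:ℝ) a, m t < M t)
    (hα : ∀ t ∈ Icc (0:ℝ) a, m t ≤ α t ∧ α t ≤ M t) :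
    ∃ t₀ ∈ Icc (0:ℝ) a,
      (∫ s in (0:ℝ)..a, α s) = (∫ s in (0:ℝ)..t₀, m s) + ∫ s in t₀..a, M s ∧
      ∀ t ∈ Icc (0:ℝ) a,
        (∫ s in (0:ℝ)..a, α s) = (∫ s in (0:ℝ)..t, m s) + ∫ s in t..a, M s → t = t₀ := by
  have h0 : (0:ℝ) ∈ Icc (0:ℝ) a := ⟨le_rfl, ha⟩
  have haa : a ∈ Icc (0:ℝ) a := ⟨ha, le_rfl⟩
  set F : ℝ → ℝ := fun t => (∫ s in (0:ℝ)..t, m s) + ∫ s in t..a, M s with hF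
  have hcF : ContinuousOn F (Icc (0:ℝ) a) := by
    rw [← uIcc_of_le ha] at hm hM ⊢
    refine (intervalIntegral.continuousOn_primitive_interval hm).add ?_
    exact intervalIntegral.continuousOn_primitive_interval_left hM
  have hanti : StrictAntiOn F (Icc (0:ℝ) a) := by
    intro u hu v hv huv
    have hsub : Icc u v ⊆ Icc (0:ℝ) a := Icc_subset_Icc hu.1 hv.2
    have hlt : ∫ s in u..v, m s < ∫ s in u..v, M s := by
      refine intervalIntegral.integral_lt_integral_of_ae_le_of_measure_setOfPred_lt_ne_zero huv.le
        (hm.intervalIntegrable_of_mem_Icc hu hv) (hM.intervalIntegrable_of_mem_Icc hu hv)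
        (ae_restrict_of_forall_mem measurableSet_Ioc fun t ht =>
          (hmM t (hsub (Ioc_subset_Icc_self ht))).le) ?_
      have hIoc : Ioc u v ⊆ {t | m t < M t} := fun t ht => hmM t (hsub (Ioc_subset_Icc_self ht))
      rw [Measure.restrict_apply' measurableSet_Ioc, inter_eq_right.2 hIoc]
      simpa using huv
    have e₁ := intervalIntegral.integral_add_adjacent_intervals
      (hm.intervalIntegrable_of_mem_Icc h0 hu) (hm.intervalIntegrable_of_mem_Icc hu hv)
    have e₂ := intervalIntegral.integral_add_adjacent_intervals
      (hM.intervalIntegrable_of_mem_Icc hu hv) (hM.intervalIntegrable_of_mem_Icc hv haa)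
    simp only [hF]
    linarith
  have hmem : (∫ s in (0:ℝ)..a, α s) ∈ Icc (F a) (F 0) := by
    have hαab := hαi.intervalIntegrable_of_mem_Icc h0 haa
    simp only [hF, intervalIntegral.integral_same, add_zero, zero_add]
    exact ⟨intervalIntegral.integral_mono_on ha (hm.intervalIntegrable_of_mem_Icc h0 haa) hαab
        fun t ht => (hα t ht).1,
      intervalIntegral.integral_mono_on ha hαab (hM.intervalIntegrable_of_mem_Icc h0 haa)
        fun t ht => (hα t ht).2⟩
  obtain ⟨t₀, ht₀, he⟩ := intermediate_value_Icc' ha hcF hmem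
  exact ⟨t₀, ht₀, he.symm, fun t ht h => hanti.injOn ht ht₀ (h.symm.trans he.symm)⟩

/-- Postponing payments to a later date at equal total does not increase their discounted value. -/
theorem integral_exp_mul_le_of_switch {r a t₀ : ℝ} {α α' : ℝ → ℝ} (hr : 0 ≤ r) (ha : 0 ≤ a)
    (hα : IntervalIntegrable α volume 0 a) (hα' : IntervalIntegrable α' volume 0 a)
    (hlt : ∀ t ∈ Icc (0:ℝ) a, t ≤ t₀ → α' t ≤ α t)
    (hgt : ∀ t ∈ Icc (0:ℝ) a, t₀ < t → α t ≤ α' t)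
    (heq : ∫ s in (0:ℝ)..a, α' s = ∫ s in (0:ℝ)..a, α s) :
    ∫ t in (0:ℝ)..a, Real.exp (-r * t) * α' t ≤ ∫ t in (0:ℝ)..a, Real.exp (-r * t) * α t := by
  have hc : ContinuousOn (fun t => Real.exp (-r * t)) (uIcc 0 a) := by fun_prop
  have hi := hα.continuousOn_mul hc
  have hi' := hα'.continuousOn_mul hc
  have hle : ∫ t in (0:ℝ)..a, (Real.exp (-r * t) * α' t - Real.exp (-r * t) * α t)
      ≤ ∫ t in (0:ℝ)..a, Real.exp (-r * t₀) * (α' t - α t) := by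
    refine intervalIntegral.integral_mono_on ha (hi'.sub hi) ((hα'.sub hα).const_mul _)
      fun t ht => ?_
    rw [← mul_sub]
    rcases le_or_gt t t₀ with h | h
    · refine mul_le_mul_of_nonpos_right (Real.exp_le_exp.2 ?_) (sub_nonpos.2 (hlt t ht h))
      nlinarith
    · refine mul_le_mul_of_nonneg_right (Real.exp_le_exp.2 ?_) (sub_nonneg.2 (hgt t ht h))
      nlinarith
  rw [intervalIntegral.integral_sub hi' hi, intervalIntegral.integral_const_mul,
    intervalIntegral.integral_sub hα' hα, heq, sub_self, mul_zero] at hle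
  linarith

/-- Postponing payments at equal total decreases the running totals. -/
theorem integral_le_of_switch {a t₀ t : ℝ} {α α' : ℝ → ℝ}
    (hα : IntegrableOn α (Icc (0:ℝ) a)) (hα' : IntegrableOn α' (Icc (0:ℝ) a))
    (hlt : ∀ t ∈ Icc (0:ℝ) a, t ≤ t₀ → α' t ≤ α t)
    (hgt : ∀ t ∈ Icc (0:ℝ) a, t₀ < t → α t ≤ α' t)
    (heq : ∫ s in (0:ℝ)..a, α' s = ∫ s in (0:ℝ)..a, α s) (ht : t ∈ Icc (0:ℝ) a) :
    ∫ s in (0:ℝ)..t, α' s ≤ ∫ s in (0:ℝ)..t, α s := by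
  have ha : 0 ≤ a := ht.1.trans ht.2
  have h0 : (0:ℝ) ∈ Icc (0:ℝ) a := ⟨le_rfl, ha⟩
  have haa : a ∈ Icc (0:ℝ) a := ⟨ha, le_rfl⟩
  rcases le_or_gt t t₀ with h | h
  · exact intervalIntegral.integral_mono_on ht.1 (hα'.intervalIntegrable_of_mem_Icc h0 ht)
      (hα.intervalIntegrable_of_mem_Icc h0 ht)
      fun s hs => hlt s ⟨hs.1, hs.2.trans ht.2⟩ (hs.2.trans h)
  · have hmono := intervalIntegral.integral_mono_on ht.2
      (hα.intervalIntegrable_of_mem_Icc ht haa) (hα'.intervalIntegrable_of_mem_Icc ht haa)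
      fun s hs => hgt s ⟨ht.1.trans hs.1, hs.2⟩ (h.trans_le hs.1)
    have e := intervalIntegral.integral_add_adjacent_intervals
      (hα.intervalIntegrable_of_mem_Icc h0 ht) (hα.intervalIntegrable_of_mem_Icc ht haa)
    have e' := intervalIntegral.integral_add_adjacent_intervals
      (hα'.intervalIntegrable_of_mem_Icc h0 ht) (hα'.intervalIntegrable_of_mem_Icc ht haa)
    linarith

theorem tauS_mem {T : ℝ} {b : ℝ → ℝ} {c : ℝ} (hc : c ≤ T)
    (h : ∀ t ∈ Icc (0:ℝ) T, b t = 0 → c ≤ t) : tauS T b ∈ Icc c T := by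
  have hlb : c ∈ lowerBounds (insert T {t | t ∈ Icc (0:ℝ) T ∧ b t = 0}) := by
    rintro t (rfl | ht)
    exacts [hc, h t ht.1 ht.2]
  exact ⟨le_csInf (insert_nonempty _ _) hlb, csInf_le ⟨c, hlb⟩ (mem_insert _ _)⟩

/-- simple interest: if `θ(α) < T`, there is a unique
`t₀ ∈ [0, θ(α)]` equalizing cumulative payments, and the modified strategy
`ᾱ = m` on `[0,t₀]`, `M` on `(t₀, θ(α)]`, `α` after, is admissible with
`θ(ᾱ) = θ(α)` and `J(x,ᾱ) ≤ J(x,α)`. -/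
theorem stmt11 (r β T ω : ℝ) (m M : ℝ → ℝ)
    (hr : 0 < r) (hβ : 0 < β) (hT : 0 < T) (hω : ω ∈ Ioo (0:ℝ) 1)
    (hmMeas : Measurable m) (hMMeas : Measurable M)
    (hmInt : IntegrableOn m (Icc (0:ℝ) T)) (hMInt : IntegrableOn M (Icc (0:ℝ) T))
    (hmM : ∀ t ∈ Icc (0:ℝ) T, 0 < m t ∧ m t < M t)
    (x : ℝ) (hx : 0 < x)
    (α : ℝ → ℝ) (hα : α ∈ Adm T m M)
    (b : ℝ → ℝ) (hb : SimpleBal r β T x α b)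
    (hθ : thetaS T x b < T) :
    ∃ t0 : ℝ, t0 ∈ Icc (0:ℝ) (thetaS T x b) ∧
      (∫ s in (0:ℝ)..(thetaS T x b), α s)
        = (∫ s in (0:ℝ)..t0, m s) + (∫ s in t0..(thetaS T x b), M s) ∧
      (∀ t0' ∈ Icc (0:ℝ) (thetaS T x b),
        ((∫ s in (0:ℝ)..(thetaS T x b), α s)
          = (∫ s in (0:ℝ)..t0', m s) + (∫ s in t0'..(thetaS T x b), M s)) →
        t0' = t0) ∧
      (fun t => if t ≤ t0 then m t else if t ≤ thetaS T x b then M t else α t)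
        ∈ Adm T m M ∧
      ∀ bbar : ℝ → ℝ,
        SimpleBal r β T x
          (fun t => if t ≤ t0 then m t else if t ≤ thetaS T x b then M t else α t)
          bbar →
        thetaS T x bbar = thetaS T x b ∧
        costS r T ω
          (fun t => if t ≤ t0 then m t else if t ≤ thetaS T x b then M t else α t)
          bbar ≤ costS r T ω α b := by
  have hθm := thetaS_mem (x := x) (b := b) hT.le
  set a := thetaS T x b with ha
  have hsub : Icc (0:ℝ) a ⊆ Icc (0:ℝ) T := Icc_subset_Icc_right hθm.2
  have hαi := integrableOn_of_mem_Adm hmInt hMInt hα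
  obtain ⟨t0, ht0, he, huniq⟩ := existsUnique_switch hθm.1 (hmInt.mono_set hsub)
    (hMInt.mono_set hsub) (hαi.mono_set hsub) (fun t ht => (hmM t (hsub ht)).2)
    (fun t ht => hα.2 t (hsub ht))
  set α' : ℝ → ℝ := fun t => if t ≤ t0 then m t else if t ≤ a then M t else α t with hα'def
  have hα' : α' ∈ Adm T m M := by
    refine ⟨Measurable.ite measurableSet_Iic hmMeas
      (Measurable.ite measurableSet_Iic hMMeas hα.1), fun t ht => ?_⟩
    have h₁ := hmM t ht
    have h₂ := hα.2 t ht
    simp only [hα'def]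
    split_ifs
    exacts [⟨le_rfl, h₁.2.le⟩, ⟨h₁.2.le, le_rfl⟩, h₂]
  refine ⟨t0, ht0, he, huniq, hα', fun bbar hbbar => ?_⟩
  have hαi' := integrableOn_of_mem_Adm hmInt hMInt hα'
  have h0T : (0:ℝ) ∈ Icc (0:ℝ) T := ⟨le_rfl, hT.le⟩
  have ht0T := hsub ht0
  have hlt : ∀ t ∈ Icc (0:ℝ) a, t ≤ t0 → α' t ≤ α t := fun t ht h => by
    simpa [hα'def, h] using (hα.2 t (hsub ht)).1
  have hgt : ∀ t ∈ Icc (0:ℝ) a, t0 < t → α t ≤ α' t := fun t ht h => by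
    simpa [hα'def, h.not_ge, ht.2] using (hα.2 t (hsub ht)).2
  have htail : ∀ t, a < t → α' t = α t := fun t h => by
    simp [hα'def, h.not_ge, (ht0.2.trans_lt h).not_ge]
  have htot : ∫ s in (0:ℝ)..a, α' s = ∫ s in (0:ℝ)..a, α s := by
    rw [he, ← intervalIntegral.integral_add_adjacent_intervals
      (hαi'.intervalIntegrable_of_mem_Icc h0T ht0T) (hαi'.intervalIntegrable_of_mem_Icc ht0T hθm)]
    congr 1
    · refine intervalIntegral.integral_congr fun s hs => ?_
      rw [uIcc_of_le ht0.1] at hs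
      simp [hα'def, hs.2]
    · refine intervalIntegral.integral_congr_ae (Filter.Eventually.of_forall fun s hs => ?_)
      rw [uIoc_of_le ht0.2] at hs
      simp [hα'def, hs.1.not_ge, hs.2]
  have hle : ∀ t ∈ Icc (0:ℝ) a, ∫ s in (0:ℝ)..t, α' s ≤ ∫ s in (0:ℝ)..t, α s := fun t ht =>
    integral_le_of_switch (hαi.mono_set hsub) (hαi'.mono_set hsub) hlt hgt htot ht
  have htailInt : ∀ (g : ℝ → ℝ) (t : ℝ), a ≤ t →
      ∫ s in a..t, g s * α' s = ∫ s in a..t, g s * α s := fun g t hat => by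
    refine intervalIntegral.integral_congr_ae (Filter.Eventually.of_forall fun s hs => ?_)
    rw [uIoc_of_le hat] at hs
    rw [htail s hs.1]
  have heq : ∀ t ∈ Icc a T, ∫ s in (0:ℝ)..t, α' s = ∫ s in (0:ℝ)..t, α s := fun t ht => by
    have htT : t ∈ Icc (0:ℝ) T := ⟨hθm.1.trans ht.1, ht.2⟩
    rw [← intervalIntegral.integral_add_adjacent_intervals
        (hαi'.intervalIntegrable_of_mem_Icc h0T hθm) (hαi'.intervalIntegrable_of_mem_Icc hθm htT),
      ← intervalIntegral.integral_add_adjacent_intervals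
        (hαi.intervalIntegrable_of_mem_Icc h0T hθm) (hαi.intervalIntegrable_of_mem_Icc hθm htT),
      htot]
    simpa using htailInt (fun _ => 1) t ht.1
  obtain ⟨hrun, hsol⟩ := hb.postpone hT.le hαi hαi' hle heq
  have hEq := hbbar.eqOn (by positivity)
    (fun t ht => hαi'.intervalIntegrable_of_mem_Icc h0T ht) hsol
  have hrunbar : ∀ t ∈ Icc (0:ℝ) T, runInf bbar t = runInf b t := fun t ht => by
    rw [← hrun t ht]
    exact congrArg sInf (image_congr fun s hs => hEq ⟨hs.1, hs.2.trans ht.2⟩)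
  refine ⟨?_, ?_⟩
  · have : {t | t ∈ Icc (0:ℝ) T ∧ runInf bbar t < x} = {t | t ∈ Icc (0:ℝ) T ∧ runInf b t < x} :=
      ext fun t => and_congr_right fun ht => by rw [hrunbar t ht]
    rw [ha, thetaS, thetaS, this]
  have h0 : b 0 = x := by simpa using hb.2 0 h0T
  have hpos : ∀ t ∈ Icc (0:ℝ) a, 0 < b t := fun t ht =>
    hx.trans_le (le_of_le_thetaS hT.le hb.1 h0.ge ht)
  have hbar_late : ∀ t ∈ Icc a T, bbar t = b t := fun t ht => by
    rw [hEq ⟨hθm.1.trans ht.1, ht.2⟩]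
    simp [heq t ht]
  have hbar_early : ∀ t ∈ Icc (0:ℝ) a, 0 < bbar t := fun t ht => by
    rw [hEq (hsub ht)]
    have := hpos t ht
    have := hle t ht
    simp only
    linarith
  have hτ : tauS T bbar = tauS T b := by
    have : {t | t ∈ Icc (0:ℝ) T ∧ bbar t = 0} = {t | t ∈ Icc (0:ℝ) T ∧ b t = 0} := by
      refine ext fun t => and_congr_right fun ht => ?_
      rcases le_total t a with h | h
      · exact iff_of_false (hbar_early t ⟨ht.1, h⟩).ne' (hpos t ⟨ht.1, h⟩).ne'
      · rw [hbar_late t ⟨h, ht.2⟩]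
    rw [tauS, tauS, this]
  have hτm : tauS T b ∈ Icc a T := tauS_mem hθm.2 fun t ht hbt => by
    by_contra! h
    exact (hpos t ⟨ht.1, h.le⟩).ne' hbt
  rw [costS, costS, hτ, hbar_late _ hτm]
  have hτT : tauS T b ∈ Icc (0:ℝ) T := ⟨hθm.1.trans hτm.1, hτm.2⟩
  have hexp : ∀ {f : ℝ → ℝ}, IntegrableOn f (Icc (0:ℝ) T) → ∀ {u v : ℝ}, u ∈ Icc (0:ℝ) T →
      v ∈ Icc (0:ℝ) T → IntervalIntegrable (fun t => Real.exp (-r * t) * f t) volume u v :=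
    fun hf _ _ hu hv => (hf.intervalIntegrable_of_mem_Icc hu hv).continuousOn_mul (by fun_prop)
  have hcost := integral_exp_mul_le_of_switch hr.le hθm.1
    (hαi.intervalIntegrable_of_mem_Icc h0T hθm) (hαi'.intervalIntegrable_of_mem_Icc h0T hθm)
    hlt hgt htot
  rw [← intervalIntegral.integral_add_adjacent_intervals (hexp hαi' h0T hθm) (hexp hαi' hθm hτT),
    ← intervalIntegral.integral_add_adjacent_intervals (hexp hαi h0T hθm) (hexp hαi hθm hτT),
    htailInt _ _ hτm.1]
  gcongr
end
end

section
/- Let α ∈ 𝒜 and 0 < τ ≤ T. If neither α(t) = m(t) for almost every t ∈ [0,τ] nor α(t) = M(t) for almost every t ∈ [0,τ], then there exists t_0 ∈ (0,τ) such that ∫_0^{t_0} (M(s) − α(s)) e^{−(r+β)s} ds = ∫_{t_0}^{τ} (α(s) − m(s)) e^{−(r+β)s} ds. -/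
open MeasureTheory Set

noncomputable section

/-- Splitting point for two integrable functions whose integrals over `[a, b]` are positive. -/
theorem exists_mem_Ioo_integral_eq_integral {a b : ℝ} (hab : a ≤ b) {f g : ℝ → ℝ}
    (hf : IntegrableOn f (Icc a b)) (hg : IntegrableOn g (Icc a b))
    (hfpos : 0 < ∫ s in a..b, f s) (hgpos : 0 < ∫ s in a..b, g s) :
    ∃ t ∈ Ioo a b, ∫ s in a..t, f s = ∫ s in t..b, g s := by
  have hfc := intervalIntegral.continuousOn_primitive_interval (f := f) (a := a) (b := b)
    (by rwa [uIcc_of_le hab])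
  have hgc := intervalIntegral.continuousOn_primitive_interval_left (f := g) (a := a) (b := b)
    (by rwa [uIcc_of_le hab])
  rw [uIcc_of_le hab] at hfc hgc
  obtain ⟨t, ht, h⟩ := intermediate_value_Ioo hab (hfc.sub hgc)
    (show (0 : ℝ) ∈ Ioo _ _ by simp [hgpos, hfpos])
  exact ⟨t, ht, sub_eq_zero.mp h⟩

/-- Two functions with `u ≤ v` on `[a, b]` that are not a.e. equal there have a positive weighted
difference integral, for every positive weight. -/
theorem integral_sub_mul_pos {a b : ℝ} (hab : a ≤ b) {u v w : ℝ → ℝ}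
    (huv : ∀ s ∈ Icc a b, u s ≤ v s) (hw : ∀ s, 0 < w s)
    (hint : IntegrableOn (fun s => (v s - u s) * w s) (Icc a b))
    (hne : ¬ ∀ᵐ s ∂(volume.restrict (Icc a b)), v s = u s) :
    0 < ∫ s in a..b, (v s - u s) * w s := by
  rw [intervalIntegral.integral_of_le hab, ← integral_Icc_eq_integral_Ioc]
  have h0 : 0 ≤ᵐ[volume.restrict (Icc a b)] fun s => (v s - u s) * w s :=
    (ae_restrict_mem measurableSet_Icc).mono fun s hs =>
      mul_nonneg (sub_nonneg.mpr (huv s hs)) (hw s).le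
  refine (integral_nonneg_of_ae h0).lt_of_ne' fun h => hne ?_
  filter_upwards [(integral_eq_zero_iff_of_nonneg_ae h0 hint).mp h] with s hs
  exact sub_eq_zero.mp ((mul_eq_zero.mp hs).resolve_right (hw s).ne')

/-- if `α` is neither a.e. minimal nor a.e. maximal on `[0,τ]`,
then some `t₀ ∈ (0,τ)` equalizes the discounted payment excesses. -/
theorem stmt16 (r β T : ℝ) (m M : ℝ → ℝ)
    (hr : 0 < r) (hβ : 0 < β) (hT : 0 < T)
    (hmMeas : Measurable m) (hMMeas : Measurable M)
    (hmInt : IntegrableOn m (Icc (0:ℝ) T)) (hMInt : IntegrableOn M (Icc (0:ℝ) T))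
    (hmM : ∀ t ∈ Icc (0:ℝ) T, 0 < m t ∧ m t < M t)
    (α : ℝ → ℝ) (hα : α ∈ Adm T m M)
    (τ : ℝ) (hτ0 : 0 < τ) (hτT : τ ≤ T)
    (hnotm : ¬ ∀ᵐ t ∂(volume.restrict (Icc (0:ℝ) τ)), α t = m t)
    (hnotM : ¬ ∀ᵐ t ∂(volume.restrict (Icc (0:ℝ) τ)), α t = M t) :
    ∃ t0 ∈ Ioo (0:ℝ) τ,
      (∫ s in (0:ℝ)..t0, (M s - α s) * Real.exp (-(r + β) * s))
        = ∫ s in t0..τ, (α s - m s) * Real.exp (-(r + β) * s) := by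
  obtain ⟨hαMeas, hαmM⟩ := hα
  have hsub : Icc (0 : ℝ) τ ⊆ Icc 0 T := Icc_subset_Icc_right hτT
  have hαInt : IntegrableOn α (Icc (0 : ℝ) T) :=
    hMInt.mono' hαMeas.aestronglyMeasurable <|
      (ae_restrict_mem measurableSet_Icc).mono fun s hs => by
        have h1 := hαmM s hs
        rw [Real.norm_of_nonneg ((hmM s hs).1.le.trans h1.1)]
        exact h1.2
  have hweight : ContinuousOn (fun s => Real.exp (-(r + β) * s)) (Icc (0 : ℝ) τ) := by fun_prop
  have hf := ((hMInt.sub hαInt).mono_set hsub).mul_continuousOn hweight isCompact_Icc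
  have hg := ((hαInt.sub hmInt).mono_set hsub).mul_continuousOn hweight isCompact_Icc
  exact exists_mem_Ioo_integral_eq_integral hτ0.le hf hg
    (integral_sub_mul_pos hτ0.le (fun s hs => (hαmM s (hsub hs)).2) (fun s => Real.exp_pos _) hf
      fun h => hnotM (h.mono fun _ => Eq.symm))
    (integral_sub_mul_pos hτ0.le (fun s hs => (hαmM s (hsub hs)).1) (fun s => Real.exp_pos _) hg
      hnotm)
end
end

section
/- Let α ∈ 𝒜, 0 < τ ≤ T and t_0 ∈ (0,τ). If ∫_0^{t_0} (M(s) − α(s)) e^{−(r+β)s} ds = ∫_{t_0}^{τ} (α(s) − m(s)) e^{−(r+β)s} ds and this common value is strictly positive, then ∫_0^{t_0} e^{−rs} (M(s) − α(s)) ds < ∫_{t_0}^{τ} e^{−rs} (α(s) − m(s)) ds. -/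
open MeasureTheory Set

noncomputable section

/-- A weight exceeding `c` on `(a, b]` strictly increases a positive integral of a nonnegative
function beyond the factor `c`. -/
theorem const_mul_integral_lt_integral_mul {a b c : ℝ} {w h : ℝ → ℝ} (hab : a < b)
    (hw : Continuous w) (hh : IntervalIntegrable h volume a b)
    (hcw : ∀ s ∈ Ioc a b, c < w s) (h_nonneg : ∀ s ∈ Ioc a b, 0 ≤ h s)
    (h_pos : 0 < ∫ s in a..b, h s) :
    c * ∫ s in a..b, h s < ∫ s in a..b, w s * h s := by
  have hwh : IntervalIntegrable (fun s => w s * h s) volume a b :=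
    hh.continuousOn_mul hw.continuousOn
  have hdiff : IntervalIntegrable (fun s => w s * h s - c * h s) volume a b :=
    hwh.sub (hh.const_mul c)
  rw [← sub_pos, ← intervalIntegral.integral_const_mul,
    ← intervalIntegral.integral_sub hwh (hh.const_mul c)]
  have ae_nonneg {f : ℝ → ℝ} (hf : ∀ s ∈ Ioc a b, 0 ≤ f s) :
      0 ≤ᵐ[volume.restrict (uIoc a b)] f := by
    rw [uIoc_of_le hab.le]
    exact ae_restrict_of_forall_mem measurableSet_Ioc hf
  rw [intervalIntegral.integral_pos_iff_support_of_nonneg_ae' (ae_nonneg h_nonneg) hh] at h_pos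
  rw [intervalIntegral.integral_pos_iff_support_of_nonneg_ae' (ae_nonneg fun s hs => ?_) hdiff]
  · refine ⟨hab, h_pos.2.trans_le (measure_mono ?_)⟩
    rintro s ⟨hs, hs'⟩
    refine ⟨?_, hs'⟩
    rw [Function.mem_support, ← sub_mul]
    exact mul_ne_zero (sub_pos.2 (hcw s hs')).ne' hs
  · rw [← sub_mul]
    exact mul_nonneg (sub_pos.2 (hcw s hs)).le (h_nonneg s hs)

theorem exp_mul_mul_exp_neg_add_mul (r β s x : ℝ) :
    Real.exp (β * s) * (x * Real.exp (-(r + β) * s)) = Real.exp (-r * s) * x := by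
  rw [mul_left_comm, ← Real.exp_add, mul_comm]
  ring_nf

/-- if the `(r+β)`-discounted payment excesses balance at `t₀` with
strictly positive common value, then the `r`-discounted excess before `t₀` is
strictly smaller than that after `t₀`. -/
theorem stmt17 (r β T : ℝ) (m M : ℝ → ℝ)
    (hr : 0 < r) (hβ : 0 < β) (hT : 0 < T)
    (hmMeas : Measurable m) (hMMeas : Measurable M)
    (hmInt : IntegrableOn m (Icc (0:ℝ) T)) (hMInt : IntegrableOn M (Icc (0:ℝ) T))
    (hmM : ∀ t ∈ Icc (0:ℝ) T, 0 < m t ∧ m t < M t)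
    (α : ℝ → ℝ) (hα : α ∈ Adm T m M)
    (τ : ℝ) (hτ0 : 0 < τ) (hτT : τ ≤ T)
    (t0 : ℝ) (ht0 : t0 ∈ Ioo (0:ℝ) τ)
    (heq : (∫ s in (0:ℝ)..t0, (M s - α s) * Real.exp (-(r + β) * s))
      = ∫ s in t0..τ, (α s - m s) * Real.exp (-(r + β) * s))
    (hpos : 0 < ∫ s in (0:ℝ)..t0, (M s - α s) * Real.exp (-(r + β) * s)) :
    (∫ s in (0:ℝ)..t0, Real.exp (-r * s) * (M s - α s))
      < ∫ s in t0..τ, Real.exp (-r * s) * (α s - m s) := by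
  obtain ⟨hαMeas, hαb⟩ := hα
  obtain ⟨h0, hτ⟩ := ht0
  have hαInt : IntegrableOn α (Icc 0 T) := by
    refine Integrable.mono' hMInt hαMeas.aestronglyMeasurable
      (ae_restrict_of_forall_mem measurableSet_Icc fun s hs => ?_)
    rw [Real.norm_eq_abs, abs_of_pos ((hmM s hs).1.trans_le (hαb s hs).1)]
    exact (hαb s hs).2
  have hsub₁ : Ioc 0 t0 ⊆ Icc 0 T := fun s hs => ⟨hs.1.le, by linarith [hs.2]⟩
  have hsub₂ : Ioc t0 τ ⊆ Icc 0 T := fun s hs => ⟨by linarith [hs.1], hs.2.trans hτT⟩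
  have hexp : Continuous fun s => Real.exp (-(r + β) * s) := by fun_prop
  have hw : Continuous fun s => Real.exp (β * s) := by fun_prop
  have hf : IntervalIntegrable (fun s => (M s - α s) * Real.exp (-(r + β) * s)) volume 0 t0 :=
    IntervalIntegrable.mul_continuousOn
      ((intervalIntegrable_iff_integrableOn_Ioc_of_le h0.le).2
        ((hMInt.sub hαInt).mono_set hsub₁)) hexp.continuousOn
  have hg : IntervalIntegrable (fun s => (α s - m s) * Real.exp (-(r + β) * s)) volume t0 τ :=
    IntervalIntegrable.mul_continuousOn
      ((intervalIntegrable_iff_integrableOn_Ioc_of_le hτ.le).2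
        ((hαInt.sub hmInt).mono_set hsub₂)) hexp.continuousOn
  simp_rw [← exp_mul_mul_exp_neg_add_mul r β]
  calc
    _ ≤ ∫ s in (0:ℝ)..t0, Real.exp (β * t0) * ((M s - α s) * Real.exp (-(r + β) * s)) := by
      refine intervalIntegral.integral_mono_on_of_le_Ioo h0.le
        (hf.continuousOn_mul hw.continuousOn) (hf.const_mul _) fun s hs => ?_
      have hs' := hαb s (hsub₁ (Ioo_subset_Ioc_self hs))
      exact mul_le_mul_of_nonneg_right
        (Real.exp_le_exp.2 (mul_le_mul_of_nonneg_left hs.2.le hβ.le))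
        (mul_nonneg (sub_nonneg.2 hs'.2) (Real.exp_pos _).le)
    _ = Real.exp (β * t0) * ∫ s in t0..τ, (α s - m s) * Real.exp (-(r + β) * s) := by
      rw [intervalIntegral.integral_const_mul, heq]
    _ < _ := by
      exact const_mul_integral_lt_integral_mul hτ hw hg
        (fun s hs => Real.exp_lt_exp.2 (mul_lt_mul_of_pos_left hs.1 hβ))
        (fun s hs => mul_nonneg (sub_nonneg.2 (hαb s (hsub₂ hs)).1) (Real.exp_pos _).le)
        (heq ▸ hpos)
end
end

section
/- Fix x > 0 and define f : [0,T] → ℝ by f(t) := ∫_0^t e^{−rs} M(s) ds + ∫_t^T e^{−rs} m(s) ds + ω e^{βT}(x − ∫_0^t e^{−(r+β)s} M(s) ds − ∫_t^T e^{−(r+β)s} m(s) ds). Then for all s, t ∈ [0,T] with s ≤ t, f(t) − f(s) = ∫_s^t e^{−ru} (M(u) − m(u)) (1 − ω e^{β(T−u)}) du; consequently f is strictly decreasing on [0, t_c], strictly increasing on [t_c, T], and attains its minimum over [0,T] uniquely at t_c. -/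
open MeasureTheory Set

noncomputable section

/-- The cost of the strategy `M` on `[0,t]`, `m` on `(t,T]`, as a function of the
switching time `t`. -/
def fAux (r β T ω x : ℝ) (m M : ℝ → ℝ) (t : ℝ) : ℝ :=
  (∫ s in (0:ℝ)..t, Real.exp (-r * s) * M s)
  + (∫ s in t..T, Real.exp (-r * s) * m s)
  + ω * Real.exp (β * T) *
    (x - (∫ s in (0:ℝ)..t, Real.exp (-(r + β) * s) * M s)
       - ∫ s in t..T, Real.exp (-(r + β) * s) * m s)

/-- The integrand of the increment formula for `fAux`. -/
def incrementIntegrand (r β T ω : ℝ) (m M : ℝ → ℝ) (u : ℝ) : ℝ :=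
  Real.exp (-r * u) * (M u - m u) * (1 - ω * Real.exp (β * (T - u)))

lemma intervalIntegrable_exp_mul {T a b : ℝ} {g : ℝ → ℝ} (k : ℝ)
    (hg : IntegrableOn g (Icc (0:ℝ) T)) (ha : a ∈ Icc (0:ℝ) T) (hb : b ∈ Icc (0:ℝ) T) :
    IntervalIntegrable (fun u => Real.exp (k * u) * g u) volume a b := by
  have h : IntervalIntegrable g volume a b :=
    (hg.mono_set (uIcc_subset_Icc ha hb)).intervalIntegrable
  exact h.continuousOn_mul (by fun_prop)

lemma incrementIntegrand_eq (r β T ω : ℝ) (m M : ℝ → ℝ) :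
    incrementIntegrand r β T ω m M = fun u =>
      (Real.exp (-r * u) * M u - Real.exp (-r * u) * m u)
      - ω * Real.exp (β * T) *
        (Real.exp (-(r + β) * u) * M u - Real.exp (-(r + β) * u) * m u) := by
  funext u
  have h₁ : Real.exp (β * (T - u)) = Real.exp (β * T) * Real.exp (-β * u) := by
    rw [← Real.exp_add]; ring_nf
  have h₂ : Real.exp (-(r + β) * u) = Real.exp (-r * u) * Real.exp (-β * u) := by
    rw [← Real.exp_add]; ring_nf
  rw [incrementIntegrand, h₁, h₂]
  ring

lemma intervalIntegrable_incrementIntegrand (r β ω : ℝ) {T a b : ℝ} {m M : ℝ → ℝ}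
    (hm : IntegrableOn m (Icc (0:ℝ) T)) (hM : IntegrableOn M (Icc (0:ℝ) T))
    (ha : a ∈ Icc (0:ℝ) T) (hb : b ∈ Icc (0:ℝ) T) :
    IntervalIntegrable (incrementIntegrand r β T ω m M) volume a b := by
  rw [incrementIntegrand_eq]
  exact ((intervalIntegrable_exp_mul _ hM ha hb).sub (intervalIntegrable_exp_mul _ hm ha hb)).sub
    (((intervalIntegrable_exp_mul _ hM ha hb).sub
      (intervalIntegrable_exp_mul _ hm ha hb)).const_mul _)

lemma fAux_sub_fAux (r β ω x : ℝ) {T s t : ℝ} {m M : ℝ → ℝ}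
    (hm : IntegrableOn m (Icc (0:ℝ) T)) (hM : IntegrableOn M (Icc (0:ℝ) T))
    (hs : s ∈ Icc (0:ℝ) T) (ht : t ∈ Icc (0:ℝ) T) :
    fAux r β T ω x m M t - fAux r β T ω x m M s
      = ∫ u in s..t, incrementIntegrand r β T ω m M u := by
  have h0 : (0:ℝ) ∈ Icc (0:ℝ) T := ⟨le_rfl, hs.1.trans hs.2⟩
  have hT : T ∈ Icc (0:ℝ) T := ⟨hs.1.trans hs.2, le_rfl⟩
  have left (k : ℝ) := intervalIntegral.integral_add_adjacent_intervals
    (intervalIntegrable_exp_mul k hM h0 hs) (intervalIntegrable_exp_mul k hM hs ht)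
  have right (k : ℝ) := intervalIntegral.integral_add_adjacent_intervals
    (intervalIntegrable_exp_mul k hm hs ht) (intervalIntegrable_exp_mul k hm ht hT)
  have iM (k : ℝ) := intervalIntegrable_exp_mul k hM hs ht
  have im (k : ℝ) := intervalIntegrable_exp_mul k hm hs ht
  rw [incrementIntegrand_eq,
    intervalIntegral.integral_sub ((iM _).sub (im _)) (((iM _).sub (im _)).const_mul _),
    intervalIntegral.integral_const_mul, intervalIntegral.integral_sub (iM _) (im _),
    intervalIntegral.integral_sub (iM _) (im _)]
  unfold fAux
  rw [← left (-r), ← left (-(r + β)), ← right (-r), ← right (-(r + β))]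
  ring

lemma mul_exp_lt_one_of_lt {β T ω u : ℝ} (hβ : 0 < β) (hω : 0 < ω)
    (hu : T + Real.log ω / β < u) : ω * Real.exp (β * (T - u)) < 1 := by
  rw [← Real.exp_log hω, ← Real.exp_add, Real.exp_lt_one_iff]
  have : Real.log ω / β < u - T := by linarith
  rw [div_lt_iff₀ hβ] at this
  linarith

lemma one_lt_mul_exp_of_lt {β T ω u : ℝ} (hβ : 0 < β) (hω : 0 < ω)
    (hu : u < T + Real.log ω / β) : 1 < ω * Real.exp (β * (T - u)) := by
  rw [← Real.exp_log hω, ← Real.exp_add, Real.one_lt_exp_iff]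
  have : u - T < Real.log ω / β := by linarith
  rw [lt_div_iff₀ hβ] at this
  linarith

/-- the increment formula for `f`, strict monotonicity on the two
sides of `t_c`, and the unique minimum of `f` at `t_c`. -/
theorem stmt18 (r β T ω : ℝ) (m M : ℝ → ℝ)
    (hr : 0 < r) (hβ : 0 < β) (hT : 0 < T) (hω : ω ∈ Ioo (0:ℝ) 1)
    (hmMeas : Measurable m) (hMMeas : Measurable M)
    (hmInt : IntegrableOn m (Icc (0:ℝ) T)) (hMInt : IntegrableOn M (Icc (0:ℝ) T))
    (hmM : ∀ t ∈ Icc (0:ℝ) T, 0 < m t ∧ m t < M t)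
    (x : ℝ) (hx : 0 < x) :
    (∀ s ∈ Icc (0:ℝ) T, ∀ t ∈ Icc (0:ℝ) T, s ≤ t →
      fAux r β T ω x m M t - fAux r β T ω x m M s
        = ∫ u in s..t,
            Real.exp (-r * u) * (M u - m u) * (1 - ω * Real.exp (β * (T - u)))) ∧
    StrictAntiOn (fAux r β T ω x m M) (Icc (0:ℝ) (tCrit β T ω)) ∧
    StrictMonoOn (fAux r β T ω x m M) (Icc (tCrit β T ω) T) ∧
    (∀ t ∈ Icc (0:ℝ) T, t ≠ tCrit β T ω →
      fAux r β T ω x m M (tCrit β T ω) < fAux r β T ω x m M t) := by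
  have htc0 : 0 ≤ tCrit β T ω := le_max_right _ _
  have htcT : tCrit β T ω ≤ T :=
    max_le (by linarith [div_neg_of_neg_of_pos (Real.log_neg hω.1 hω.2) hβ]) hT.le
  have anti : StrictAntiOn (fAux r β T ω x m M) (Icc (0:ℝ) (tCrit β T ω)) := by
    intro s hs t ht hst
    have hs' : s ∈ Icc (0:ℝ) T := ⟨hs.1, hs.2.trans htcT⟩
    have ht' : t ∈ Icc (0:ℝ) T := ⟨ht.1, ht.2.trans htcT⟩
    have key := intervalIntegral.intervalIntegral_pos_of_pos_on
      (intervalIntegrable_incrementIntegrand r β ω hmInt hMInt hs' ht').neg (fun u hu => by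
        have hu0 : 0 < u := hs.1.trans_lt hu.1
        have hlt : u < T + Real.log ω / β :=
          (lt_max_iff.1 (hu.2.trans_le ht.2)).resolve_right hu0.not_gt
        have h₁ := (hmM u ⟨hu0.le, hu.2.le.trans ht'.2⟩).2
        have h₂ := one_lt_mul_exp_of_lt hβ hω.1 hlt
        exact neg_pos.2 (mul_neg_of_pos_of_neg
          (mul_pos (Real.exp_pos _) (sub_pos.2 h₁)) (sub_neg.2 h₂))) hst
    simp only [Pi.neg_apply, intervalIntegral.integral_neg] at key
    linarith [fAux_sub_fAux r β ω x hmInt hMInt hs' ht']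
  have mono : StrictMonoOn (fAux r β T ω x m M) (Icc (tCrit β T ω) T) := by
    intro s hs t ht hst
    have hs' : s ∈ Icc (0:ℝ) T := ⟨htc0.trans hs.1, hs.2⟩
    have ht' : t ∈ Icc (0:ℝ) T := ⟨htc0.trans ht.1, ht.2⟩
    have key := intervalIntegral.intervalIntegral_pos_of_pos_on
      (intervalIntegrable_incrementIntegrand r β ω hmInt hMInt hs' ht') (fun u hu => by
        have h₁ := (hmM u ⟨hs'.1.trans hu.1.le, hu.2.le.trans ht.2⟩).2
        have h₂ := mul_exp_lt_one_of_lt hβ hω.1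
          ((le_max_left _ _).trans_lt (hs.1.trans_lt hu.1))
        exact mul_pos (mul_pos (Real.exp_pos _) (sub_pos.2 h₁)) (sub_pos.2 h₂)) hst
    linarith [fAux_sub_fAux r β ω x hmInt hMInt hs' ht']
  refine ⟨fun s hs t ht _ => fAux_sub_fAux r β ω x hmInt hMInt hs ht, anti, mono, ?_⟩
  intro t ht hne
  rcases lt_or_gt_of_ne hne with h | h
  · exact anti ⟨ht.1, h.le⟩ ⟨htc0, le_rfl⟩ h
  · exact mono ⟨le_rfl, htcT⟩ ⟨h.le, ht.2⟩ h
end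
end
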